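/- The eigenvalues of the Gaussian R-matrix G_d are μ_l = d^{-1/2} Σ_{k=0}^{d-1} ξ^{k²} e^{2πilk/d} for l = 0,…,d-1, and every eigenvalue satisfies μ_l^{4d} = 1, i.e. all eigenvalues of G_d are 4d-th roots of unity. -/

import Mathlib

open Matrix Kronecker Complex

/-- The algebra `M_d ⊗ M_d` realized as matrices indexed by pairs. -/
abbrev MM (d : ℕ) := Matrix (Fin d × Fin d) (Fin d × Fin d) ℂ

/-- `R ⊗ 1` acting on the triple tensor product `ℂ^d ⊗ ℂ^d ⊗ ℂ^d`. -/
def amp1 {d : ℕ} (R : MM d) :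
    Matrix (Fin d × Fin d × Fin d) (Fin d × Fin d × Fin d) ℂ :=
  Matrix.of fun x y => R (x.1, x.2.1) (y.1, y.2.1) * (if x.2.2 = y.2.2 then 1 else 0)

/-- `1 ⊗ R` acting on the triple tensor product `ℂ^d ⊗ ℂ^d ⊗ ℂ^d`. -/
def amp2 {d : ℕ} (R : MM d) :
    Matrix (Fin d × Fin d × Fin d) (Fin d × Fin d × Fin d) ℂ :=
  Matrix.of fun x y => (if x.1 = y.1 then 1 else 0) * R (x.2.1, x.2.2) (y.2.1, y.2.2)

/-- The Yang-Baxter equation `(R⊗1)(1⊗R)(R⊗1) = (1⊗R)(R⊗1)(1⊗R)`. -/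
def YBE {d : ℕ} (R : MM d) : Prop :=
  amp1 R * amp2 R * amp1 R = amp2 R * amp1 R * amp2 R

/-- The root of unity `ξ`: `e^{2πi/d}` for `d` odd, `e^{πi/d}` for `d` even. -/
noncomputable def xi (d : ℕ) : ℂ :=
  if Odd d then Complex.exp (2 * Real.pi * Complex.I / d)
  else Complex.exp (Real.pi * Complex.I / d)

/-- The unitary `U` on `ℂ^d ⊗ ℂ^d` with `U(e_k ⊗ e_l) = ξ^{l-k} e_{k+1} ⊗ e_{l+1}`,
indices mod `d`. -/
noncomputable def Ug (d : ℕ) [NeZero d] : MM d :=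
  Matrix.of fun p q =>
    if p.1 = q.1 + 1 ∧ p.2 = q.2 + 1 then xi d ^ ((q.2 : ℤ) - (q.1 : ℤ)) else 0

/-- The Gaussian R-matrix `G_d = d^{-1/2} Σ_k ξ^{k²} U^k`. -/
noncomputable def Gg (d : ℕ) [NeZero d] : MM d :=
  ((Real.sqrt d : ℂ))⁻¹ • ∑ k ∈ Finset.range d, xi d ^ (k ^ 2) • Ug d ^ k

/-- The numbers `μ_l = d^{-1/2} Σ_{k=0}^{d-1} ξ^{k²} e^{2πilk/d}`. -/
noncomputable def mu (d : ℕ) (l : ℕ) : ℂ :=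
  ((Real.sqrt d : ℂ))⁻¹ * ∑ k ∈ Finset.range d,
    xi d ^ (k ^ 2) * Complex.exp (2 * Real.pi * Complex.I * l * k / d)

open Finset in
theorem aux_shift {f : ℕ → ℂ} {d : ℕ} (hf : ∀ k, f (k + d) = f k) (m : ℕ) :
    ∑ k ∈ range d, f (k + m) = ∑ k ∈ range d, f k := by
  induction m with
  | zero => simp
  | succ m ih =>
    rw [← ih]
    have h1 := Finset.sum_range_succ (fun k => f (k + m)) d
    have h2 := Finset.sum_range_succ' (fun k => f (k + m)) d
    rw [h1] at h2
    have h3 : f (d + m) = f (0 + m) := by rw [add_comm d m, hf, zero_add]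
    rw [h3] at h2
    have := add_right_cancel h2
    rw [this]
    refine Finset.sum_congr rfl fun k _ => ?_
    congr 1; ring

theorem aux_xi2 (d : ℕ) (hd : 2 ≤ d) : IsPrimitiveRoot (xi d ^ 2) d := by
  have hd0 : d ≠ 0 := by omega
  have hp := Complex.isPrimitiveRoot_exp d hd0
  unfold xi
  split_ifs with h
  · exact hp.pow_of_coprime 2 (Nat.coprime_two_left.mpr h)
  · rw [← Complex.exp_nat_mul]
    convert hp using 2
    push_cast; ring

theorem aux_xidd (d : ℕ) (hd : 2 ≤ d) : xi d ^ (d * d) = 1 := by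
  have hd0 : d ≠ 0 := by omega
  by_cases h : Odd d
  · have hp := Complex.isPrimitiveRoot_exp d hd0
    unfold xi
    rw [if_pos h, pow_mul, hp.pow_eq_one, one_pow]
  · obtain ⟨r, hr⟩ := Nat.not_odd_iff_even.mp h
    have : d * d = 2 * d * r := by rw [← two_mul] at hr; nlinarith
    rw [this, pow_mul, pow_mul, (aux_xi2 d hd).pow_eq_one, one_pow]

theorem aux_xi2d (d : ℕ) (hd : 2 ≤ d) : xi d ^ (2 * d) = 1 := by
  rw [pow_mul, (aux_xi2 d hd).pow_eq_one]

theorem aux_xi0 (d : ℕ) (hd : 2 ≤ d) : xi d ≠ 0 := by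
  intro h
  have := aux_xi2d d hd
  rw [h, zero_pow (by omega)] at this
  exact zero_ne_one this

/-- Unnormalised Gauss sum. -/
noncomputable def gs (d : ℕ) : ℂ := ∑ k ∈ Finset.range d, xi d ^ (k ^ 2)

theorem aux_gs (d : ℕ) (hd : 2 ≤ d) (m : ℕ) :
    xi d ^ (m ^ 2) * ∑ k ∈ Finset.range d, xi d ^ (k ^ 2 + 2 * m * k) = gs d := by
  have := aux_shift (f := fun k => xi d ^ (k ^ 2)) (d := d) (by
    intro k
    have : (k + d) ^ 2 = k ^ 2 + 2 * d * k + d * d := by ring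
    simp only [this]
    rw [pow_add, pow_add, pow_mul, aux_xi2d d hd, aux_xidd d hd]; simp) m
  rw [gs, ← this, Finset.mul_sum]
  refine Finset.sum_congr rfl fun k _ => ?_
  rw [← pow_add]; congr 1; ring

theorem aux_sumsq (d : ℕ) (hd : 2 ≤ d) : 
    12 * ∑ j ∈ Finset.range d, j ^ 2 = 2 * d * ((d - 1) * (2 * d - 1)) := by
  obtain ⟨n, rfl⟩ : ∃ n, d = n + 1 := ⟨d - 1, by omega⟩
  have : 2 * (n + 1) - 1 = 2 * n + 1 := by omega
  rw [this, Nat.add_sub_cancel]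
  clear hd this
  induction n with
  | zero => simp
  | succ n ih => rw [Finset.sum_range_succ, mul_add, ih]; ring

noncomputable def Sm (d : ℕ) : Matrix (Fin d) (Fin d) ℂ :=
  Matrix.of fun j k => xi d ^ (2 * (j : ℕ) * (k : ℕ))
noncomputable def Sb (d : ℕ) : Matrix (Fin d) (Fin d) ℂ :=
  Matrix.of fun j k => (xi d ^ (2 * (j : ℕ) * (k : ℕ)))⁻¹
noncomputable def Tm (d : ℕ) : Matrix (Fin d) (Fin d) ℂ :=
  Matrix.diagonal fun j => xi d ^ ((j : ℕ) ^ 2)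

theorem aux_TSTST (d : ℕ) (hd : 2 ≤ d) :
    Tm d * (Sm d * Tm d * Sm d) * Tm d = gs d • Sb d := by
  ext j l
  have h0 := aux_xi0 d hd
  simp only [Tm, Matrix.mul_diagonal, Matrix.diagonal_mul, Matrix.smul_apply, smul_eq_mul]
  rw [Matrix.mul_apply]
  simp only [Matrix.mul_diagonal, Sm, Sb, Matrix.of_apply]
  rw [Fin.sum_univ_eq_sum_range
    (fun k => xi d ^ (2 * (j : ℕ) * k) * xi d ^ (k ^ 2) * xi d ^ (2 * k * (l : ℕ))) d,
    ← aux_gs d hd (j + l)]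
  rw [eq_mul_inv_iff_mul_eq₀ (pow_ne_zero _ h0)]
  have : ((j : ℕ) + l) ^ 2 = j ^ 2 + l ^ 2 + 2 * j * l := by ring
  rw [this, pow_add, pow_add]
  have : ∀ k : ℕ, xi d ^ (2 * (j : ℕ) * k) * xi d ^ (k ^ 2) * xi d ^ (2 * k * (l : ℕ))
      = xi d ^ (k ^ 2 + 2 * (j + l) * k) := by
    intro k; rw [← pow_add, ← pow_add]; congr 1; ring
  simp only [this]
  ring

theorem aux_SSb (d : ℕ) (hd : 2 ≤ d) : Sm d * Sb d = (d : ℂ) • 1 := by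
  have h0 := aux_xi0 d hd
  have hp := aux_xi2 d hd
  ext j l
  rw [Matrix.mul_apply]
  simp only [Sm, Sb, Matrix.of_apply, Matrix.smul_apply, smul_eq_mul]
  set a := (xi d ^ 2) ^ (j : ℕ) * ((xi d ^ 2) ^ (l : ℕ))⁻¹ with ha
  have h1 : ∀ k : ℕ, xi d ^ (2 * (j : ℕ) * k) * (xi d ^ (2 * k * (l : ℕ)))⁻¹ = a ^ k := by
    intro k
    rw [ha, mul_pow, inv_pow]
    simp only [← pow_mul]
    congr 3; ring
  simp only [h1]
  rw [Fin.sum_univ_eq_sum_range (fun k => a ^ k) d]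
  by_cases hjl : j = l
  · subst hjl
    have : a = 1 := by rw [ha]; exact mul_inv_cancel₀ (pow_ne_zero _ (pow_ne_zero _ h0))
    simp [this]
  · rw [Matrix.one_apply_ne hjl, mul_zero]
    have had : a ^ d = 1 := by
      rw [ha, mul_pow, inv_pow, pow_right_comm _ (j : ℕ) d, pow_right_comm _ (l : ℕ) d,
        hp.pow_eq_one]; simp
    have ha1 : a ≠ 1 := by
      intro h
      rw [ha, mul_inv_eq_one₀ (pow_ne_zero _ (pow_ne_zero _ h0))] at h
      exact hjl (Fin.ext (hp.pow_inj j.2 l.2 h))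
    rw [geom_sum_eq ha1, had]; simp

theorem aux_Sb (d : ℕ) [NeZero d] (hd : 2 ≤ d) :
    Sb d = (Sm d).submatrix id (Equiv.neg (Fin d)) := by
  have h0 := aux_xi0 d hd
  ext j k
  simp only [Sm, Sb, Matrix.of_apply, Matrix.submatrix_apply, id, Equiv.neg_apply]
  rw [inv_eq_iff_eq_inv, ← one_div, eq_div_iff (pow_ne_zero _ h0), ← pow_add, ← mul_add]
  have h : ((k + -k : Fin d) : ℕ) = 0 := by simp
  rw [Fin.val_add] at h
  obtain ⟨c, hc⟩ := Nat.dvd_of_mod_eq_zero h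
  rw [hc]
  have : 2 * (j : ℕ) * (d * c) = 2 * d * (j * c) := by ring
  rw [this, pow_mul, aux_xi2d d hd, one_pow]

theorem aux_detT (d : ℕ) (hd : 2 ≤ d) : (Tm d).det ^ 12 = 1 := by
  rw [Tm, Matrix.det_diagonal, Fin.prod_univ_eq_prod_range (fun j => xi d ^ (j ^ 2)) d,
    Finset.prod_pow_eq_pow_sum, ← pow_mul, mul_comm, aux_sumsq d hd, pow_mul, aux_xi2d d hd,
    one_pow]

theorem aux_gs4 (d : ℕ) [NeZero d] (hd : 2 ≤ d) : gs d ^ (4 * d) = (d : ℂ) ^ (2 * d) := by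
  have hT := aux_detT d hd
  have h1 := congrArg Matrix.det (aux_TSTST d hd)
  have h2 := congrArg Matrix.det (aux_SSb d hd)
  have h3 := congrArg Matrix.det (aux_Sb d hd)
  rw [Matrix.det_permute'] at h3
  simp only [Matrix.det_mul, Matrix.det_smul, Fintype.card_fin, Matrix.det_one, mul_one] at h1 h2
  set τ := (Tm d).det
  set D := (Sm d).det
  set D' := (Sb d).det
  set s : ℂ := ((Equiv.Perm.sign (Equiv.neg (Fin d)) : ℤ) : ℂ) with hs
  have hs2 : s ^ 2 = 1 := by
    rw [hs]; norm_cast; simp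
  have hd0 : (d : ℂ) ≠ 0 := by exact_mod_cast (by omega : d ≠ 0)
  set e := (d : ℂ) ^ d with he
  have he0 : e ≠ 0 := pow_ne_zero _ hd0
  have h4 : D ^ 4 = e ^ 2 := by
    rw [← h2, h3]; linear_combination (- D ^ 4) * hs2
  have h5 : τ ^ 3 * D ^ 3 = gs d ^ d * e := by
    rw [← h2]; linear_combination D * h1
  have h6 : (gs d ^ d) ^ 4 * e ^ 4 = e ^ 2 * e ^ 4 := by
    calc (gs d ^ d) ^ 4 * e ^ 4 = (τ ^ 3 * D ^ 3) ^ 4 := by rw [h5]; ring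
      _ = τ ^ 12 * (D ^ 4) ^ 3 := by ring
      _ = _ := by rw [hT, h4]; ring
  have h7 := mul_right_cancel₀ (pow_ne_zero 4 he0) h6
  rw [mul_comm 4, pow_mul, h7, he, ← pow_mul, mul_comm]

theorem aux_mu (d : ℕ) [NeZero d] (hd : 2 ≤ d) (l : ℕ) : mu d l ^ (4 * d) = 1 := by
  have h0 := aux_xi0 d hd
  have hd0 : (d : ℂ) ≠ 0 := by exact_mod_cast (by omega : d ≠ 0)
  obtain ⟨m, -, hm⟩ := (aux_xi2 d hd).eq_pow_of_pow_eq_one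
    (ξ := Complex.exp (2 * Real.pi * Complex.I * l / d)) (by
      rw [← Complex.exp_nat_mul, Complex.exp_eq_one_iff]
      exact ⟨l, by field_simp; push_cast; ring⟩)
  have h1 : mu d l = ((Real.sqrt d : ℂ))⁻¹ *
      ∑ k ∈ Finset.range d, xi d ^ (k ^ 2 + 2 * m * k) := by
    unfold mu
    congr 1
    refine Finset.sum_congr rfl fun k _ => ?_
    rw [pow_add, pow_mul, pow_mul, hm, ← Complex.exp_nat_mul]
    congr 2; ring
  have h2 : xi d ^ (m ^ 2) * mu d l = ((Real.sqrt d : ℂ))⁻¹ * gs d := by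
    rw [h1, ← aux_gs d hd m]; ring
  have h3 := congrArg (· ^ (4 * d)) h2
  simp only [mul_pow] at h3
  rw [← pow_mul, show m ^ 2 * (4 * d) = 2 * d * (2 * m ^ 2) by ring, pow_mul, aux_xi2d d hd,
    one_pow, one_mul, aux_gs4 d hd] at h3
  have h4 : ((Real.sqrt d : ℂ)) ^ 2 = d := by
    rw [← Complex.ofReal_pow, Real.sq_sqrt (Nat.cast_nonneg d)]; simp
  rw [h3, inv_pow, show 4 * d = 2 * (2 * d) by ring, pow_mul, h4]
  exact inv_mul_cancel₀ (pow_ne_zero _ hd0)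

open scoped Fin.CommRing in
theorem aux_Upow (d : ℕ) [NeZero d] (n : ℕ) (p q : Fin d × Fin d) :
    (Ug d ^ n) p q = if p.1 = q.1 + (n : Fin d) ∧ p.2 = q.2 + (n : Fin d) then
      ∏ j ∈ Finset.range n,
        xi d ^ (((q.2 + (j : Fin d) : Fin d) : ℤ) - ((q.1 + (j : Fin d) : Fin d) : ℤ)) else 0 := by
  induction n generalizing p with
  | zero => simp [Matrix.one_apply, Prod.ext_iff]
  | succ n ih =>
    rw [pow_succ', Matrix.mul_apply, Finset.sum_eq_single (q.1 + (n : Fin d), q.2 + (n : Fin d))]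
    · rw [ih]
      simp only [Ug, Matrix.of_apply, and_self, if_true, Finset.prod_range_succ, Nat.cast_succ,
        add_assoc]
      split_ifs
      · ring
      · simp
    · intro b _ hb
      rw [ih, if_neg, mul_zero]
      rintro ⟨h1, h2⟩
      exact hb (Prod.ext h1 h2)
    · simp

open scoped Fin.CommRing in
theorem aux_Ud (d : ℕ) [NeZero d] (hd : 2 ≤ d) : Ug d ^ d = 1 := by
  have h0 := aux_xi0 d hd
  have key : ∀ a : Fin d, ∏ j ∈ Finset.range d, xi d ^ (((a + (j : Fin d) : Fin d) : ℤ))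
      = ∏ j : Fin d, xi d ^ ((j : Fin d) : ℤ) := by
    intro a
    rw [← Fin.prod_univ_eq_prod_range (fun j => xi d ^ (((a + (j : Fin d) : Fin d) : ℤ))) d]
    simp only [Fin.cast_val_eq_self]
    exact Equiv.prod_comp (Equiv.addLeft a) (fun j : Fin d => xi d ^ ((j : Fin d) : ℤ))
  ext p q
  rw [aux_Upow]
  simp only [zpow_sub₀ h0, Finset.prod_div_distrib, key, Fin.natCast_self, add_zero,
    Matrix.one_apply, Prod.ext_iff]
  rw [div_self (Finset.prod_ne_zero_iff.mpr fun j _ => zpow_ne_zero _ h0)]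

theorem aux_specU (d : ℕ) [NeZero d] (hd : 2 ≤ d) :
    spectrum ℂ (Ug d) = {z : ℂ | z ^ d = 1} := by
  ext z
  have : Nonempty (Fin d × Fin d) := ⟨(0, 0)⟩
  constructor
  · intro hz
    have := spectrum.pow_mem_pow (Ug d) d hz
    rw [aux_Ud d hd, spectrum.one_eq] at this
    exact this
  · intro hz
    have hz : z ^ d = 1 := hz
    have hz0 : z ≠ 0 := by
      rintro rfl
      rw [zero_pow (by omega)] at hz
      exact zero_ne_one hz
    rw [← Matrix.spectrum_toLin']
    apply Module.End.HasEigenvalue.mem_spectrum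
    refine Module.End.hasEigenvalue_of_hasEigenvector
      (x := fun p : Fin d × Fin d => if p.1 = p.2 then (z⁻¹) ^ (p.1 : ℕ) else 0) ⟨?_, ?_⟩
    · rw [Module.End.mem_eigenspace_iff]
      ext p
      rw [Matrix.toLin'_apply]
      simp only [Matrix.mulVec, dotProduct, Pi.smul_apply, smul_eq_mul]
      rw [Finset.sum_eq_single (p.1 - 1, p.2 - 1)]
      · simp only [Ug, Matrix.of_apply, sub_add_cancel, and_self, if_true, sub_left_inj]
        split_ifs with h
        · rw [h]
          simp only [sub_self, zpow_zero, one_mul]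
          have h1 : ((p.2 - 1 + 1 : Fin d) : ℕ) = (p.2 : ℕ) := by simp
          rw [Fin.val_add] at h1
          have h2 : ((1 : Fin d) : ℕ) = 1 := by
            rw [Fin.val_one']; exact Nat.mod_eq_of_lt (by omega)
          rw [h2] at h1
          have h3 : (z⁻¹) ^ (p.2 : ℕ) = (z⁻¹) ^ (((p.2 - 1 : Fin d) : ℕ) + 1) := by
            rw [← h1]
            exact (pow_eq_pow_mod _ (by rw [inv_pow, hz, inv_one])).symm
          rw [h3, pow_succ]
          field_simp
        · simp
      · intro b _ hb
        simp only [Ug, Matrix.of_apply]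
        rw [if_neg, zero_mul]
        rintro ⟨h1, h2⟩
        exact hb (Prod.ext (by simp [h1]) (by simp [h2]))
      · simp
    · intro h
      have := congrFun h (0, 0)
      simp at this

open Polynomial in
theorem aux_specG (d : ℕ) [NeZero d] (hd : 2 ≤ d) :
    spectrum ℂ (Gg d) = {z : ℂ | ∃ l < d, z = mu d l} := by
  have : Nonempty (Fin d × Fin d) := ⟨(0, 0)⟩
  have hd0 : d ≠ 0 := by omega
  set P : ℂ[X] := C ((Real.sqrt d : ℂ))⁻¹ * ∑ k ∈ Finset.range d, C (xi d ^ (k ^ 2)) * X ^ k with hP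
  have hG : Gg d = aeval (Ug d) P := by
    simp [hP, Gg, Algebra.smul_def]
  have hmu : ∀ l : ℕ, mu d l = P.eval (Complex.exp (2 * Real.pi * Complex.I / d) ^ l) := by
    intro l
    simp only [hP, mu, eval_mul, eval_C, eval_finsetSum, eval_pow, eval_X]
    congr 1
    refine Finset.sum_congr rfl fun k _ => ?_
    rw [← Complex.exp_nat_mul, ← Complex.exp_nat_mul]
    congr 2; ring
  have hp := Complex.isPrimitiveRoot_exp d hd0
  rw [hG, spectrum.map_polynomial_aeval_of_nonempty (𝕜 := ℂ) (a := Ug d) (p := P) (by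
    rw [aux_specU d hd]; exact ⟨1, one_pow d⟩), aux_specU d hd]
  ext z
  constructor
  · rintro ⟨w, hw, rfl⟩
    obtain ⟨l, hl, rfl⟩ := hp.eq_pow_of_pow_eq_one hw
    exact ⟨l, hl, (hmu l).symm⟩
  · rintro ⟨l, hl, rfl⟩
    refine ⟨_, ?_, (hmu l).symm⟩
    show _ ^ d = 1
    rw [pow_right_comm, hp.pow_eq_one, one_pow]


/-- The eigenvalues of the Gaussian R-matrix `G_d` are exactly the numbers `μ_l`,
`l = 0, …, d-1`, and all of them are `4d`-th roots of unity. -/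
theorem gaussian_eigenvalues (d : ℕ) [NeZero d] (hd : 2 ≤ d) :
    spectrum ℂ (Gg d) = {z : ℂ | ∃ l < d, z = mu d l} ∧
      ∀ l < d, mu d l ^ (4 * d) = 1 := by
  exact ⟨aux_specG d hd, fun l _ => aux_mu d hd l⟩
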